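/- Let (E,𝓑,m) be a σ-finite measure space, let D₀ be a dense linear subspace of L²(m) and L₀ : D₀ → L²(m) a symmetric linear operator (i.e. ∫ (L₀u)·v dm = ∫ u·(L₀v) dm for u,v ∈ D₀). Assume that for every T ∈ (0,∞) the linear span of the functions (s,x) ↦ f'(s)φ(x) + f(s)(L₀φ)(x), where φ ∈ D₀ and f ∈ C¹([0,T];ℝ) with f(T) = 0, is dense in L²([0,T]×E, dt⊗m). Then any two strongly continuous semigroups (T_t)_{t≥0} and (T̃_t)_{t≥0} on L²(m), each consisting of self-adjoint bounded operators and each satisfying T_t φ = φ + ∫₀ᵗ T_s(L₀φ) ds (resp. T̃_t φ = φ + ∫₀ᵗ T̃_s(L₀φ) ds, Bochner integrals in L²(m)) for all φ ∈ D₀ and t ≥ 0, coincide: T_t = T̃_t for all t ≥ 0. -/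

import Mathlib

open MeasureTheory Set

noncomputable section

/-- A strongly continuous semigroup of bounded linear operators on a normed space. -/
def IsStrongSemigroup {X : Type*} [NormedAddCommGroup X] [NormedSpace ℝ X]
    (T : ℝ → X →L[ℝ] X) : Prop :=
  T 0 = ContinuousLinearMap.id ℝ X ∧
  (∀ s t : ℝ, 0 ≤ s → 0 ≤ t → T (s + t) = (T s).comp (T t)) ∧
  (∀ u : X, ContinuousOn (fun t => T t u) (Set.Ici (0 : ℝ)))

/-- Self-adjointness of a bounded operator on `L²(m)`, expressed via integrals. -/
def IsSelfAdjointOp {α : Type*} [MeasurableSpace α] (m : Measure α)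
    (S : Lp ℝ 2 m →L[ℝ] Lp ℝ 2 m) : Prop :=
  ∀ v w : Lp ℝ 2 m, ∫ x, (S v : α → ℝ) x * (w : α → ℝ) x ∂m
    = ∫ x, (v : α → ℝ) x * (S w : α → ℝ) x ∂m

open scoped InnerProductSpace in
/-- A norm-bounded sequence in an inner product space that converges weakly to `0` when tested
against a dense submodule converges weakly to `0`. -/
theorem tendsto_inner_zero_of_dense {H : Type*} [NormedAddCommGroup H] [InnerProductSpace ℝ H]
    {U : ℕ → H} {C : ℝ} (hU : ∀ n, ‖U n‖ ≤ C) {S : Submodule ℝ H} (hS : Dense (S : Set H))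
    (h : ∀ k ∈ S, Filter.Tendsto (fun n => ⟪U n, k⟫_ℝ) Filter.atTop (nhds 0)) (K : H) :
    Filter.Tendsto (fun n => ⟪U n, K⟫_ℝ) Filter.atTop (nhds 0) := by
  have hC : 0 ≤ C := (norm_nonneg _).trans (hU 0)
  rw [Metric.tendsto_atTop]
  intro ε hε
  obtain ⟨k, hkS, hk⟩ := Metric.dense_iff.1 hS K (ε / (2 * (C + 1))) (by positivity)
  rw [Metric.mem_ball, dist_eq_norm] at hkS
  obtain ⟨N, hN⟩ := (Metric.tendsto_atTop.1 (h k hk)) (ε / 2) (by positivity)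
  refine ⟨N, fun n hn => ?_⟩
  have h1 := hN n hn
  rw [Real.dist_eq, sub_zero] at h1 ⊢
  have h2 : |⟪U n, k - K⟫_ℝ| ≤ ε / 2 := by
    calc |⟪U n, k - K⟫_ℝ| ≤ ‖U n‖ * ‖k - K‖ := abs_real_inner_le_norm _ _
      _ ≤ (C + 1) * (ε / (2 * (C + 1))) :=
        mul_le_mul ((hU n).trans (by linarith)) hkS.le (norm_nonneg _) (by linarith)
      _ = ε / 2 := by field_simp
  rw [inner_sub_right] at h2
  have h3 := abs_sub_abs_le_abs_sub (⟪U n, K⟫_ℝ) (⟪U n, k⟫_ℝ)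
  rw [abs_sub_comm] at h3
  linarith

namespace MeasureTheory

variable {α β : Type*} [MeasurableSpace α] [MeasurableSpace β]

theorem SimpleFunc.measurable_uncurry_Lp (m : Measure α) (a : SimpleFunc β (Lp ℝ 2 m)) :
    Measurable fun z : β × α => (a z.1 : α → ℝ) z.2 :=
  SimpleFunc.measurable_bind (a.comp Prod.fst measurable_fst)
    (fun (y : Lp ℝ 2 m) (z : β × α) => (y : α → ℝ) z.2)
    fun y => (Lp.stronglyMeasurable y).measurable.comp measurable_snd

theorem SimpleFunc.eLpNorm_uncurry_Lp_le (μ : Measure β) [IsFiniteMeasure μ] (m : Measure α)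
    [SigmaFinite m] (a : SimpleFunc β (Lp ℝ 2 m)) {C : ℝ} (ha : ∀ s, ‖a s‖ ≤ C) :
    eLpNorm (fun z : β × α => (a z.1 : α → ℝ) z.2) 2 (μ.prod m)
      ≤ (ENNReal.ofReal C ^ (2 : ℝ) * μ univ) ^ (1 / 2 : ℝ) := by
  rw [eLpNorm_eq_lintegral_rpow_enorm_toReal (by simp) (by simp), ENNReal.toReal_ofNat,
    lintegral_prod _ ((a.measurable_uncurry_Lp m).enorm.pow_const _).aemeasurable]
  gcongr
  rw [← lintegral_const]
  refine lintegral_mono_fn' le_rfl fun s => ?_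
  have h := eLpNorm_nnreal_pow_eq_lintegral (f := (a s : α → ℝ)) (μ := m) (p := 2) (by simp)
  simp only [NNReal.coe_ofNat] at h
  rw [← h]
  gcongr
  rw [ENNReal.coe_ofNat, ← ENNReal.ofReal_toReal (Lp.eLpNorm_ne_top (a s)), ← Lp.norm_def]
  exact ENNReal.ofReal_le_ofReal (ha s)

theorem SimpleFunc.memLp_uncurry_Lp (μ : Measure β) [IsFiniteMeasure μ] (m : Measure α)
    [SigmaFinite m] (a : SimpleFunc β (Lp ℝ 2 m)) {C : ℝ} (ha : ∀ s, ‖a s‖ ≤ C) :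
    MemLp (fun z : β × α => (a z.1 : α → ℝ) z.2) 2 (μ.prod m) := by
  refine ⟨(a.measurable_uncurry_Lp m).aestronglyMeasurable,
    (a.eLpNorm_uncurry_Lp_le μ m ha).trans_lt ?_⟩
  exact ENNReal.rpow_lt_top_of_nonneg (by norm_num)
    (ENNReal.mul_ne_top (ENNReal.rpow_ne_top_of_nonneg (by norm_num) ENNReal.ofReal_ne_top)
      (measure_ne_top _ _))

theorem MemLp.mul_prod_of_bound (μ : Measure β) [IsFiniteMeasure μ] (m : Measure α)
    [SigmaFinite m] {g : β → ℝ} (hg : AEStronglyMeasurable g μ) {D : ℝ}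
    (hD : ∀ᵐ s ∂μ, ‖g s‖ ≤ D) {ψ : α → ℝ} (hψ : MemLp ψ 2 m) :
    MemLp (fun z : β × α => g z.1 * ψ z.2) 2 (μ.prod m) := by
  have h : MemLp (fun z : β × α => g z.1) ⊤ (μ.prod m) :=
    memLp_top_of_bound hg.comp_fst D (Measure.quasiMeasurePreserving_fst.ae hD)
  exact MemLp.mul (hψ.comp_snd μ) h

open scoped InnerProductSpace in
theorem SimpleFunc.integral_uncurry_Lp_mul (μ : Measure β) [IsFiniteMeasure μ] (m : Measure α)
    [SigmaFinite m] (a : SimpleFunc β (Lp ℝ 2 m)) {C : ℝ} (ha : ∀ s, ‖a s‖ ≤ C)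
    {g : β → ℝ} (hg : AEStronglyMeasurable g μ) {D : ℝ}
    (hD : ∀ᵐ s ∂μ, ‖g s‖ ≤ D) (ψ : Lp ℝ 2 m) :
    ∫ z, (a z.1 : α → ℝ) z.2 * (g z.1 * (ψ : α → ℝ) z.2) ∂(μ.prod m)
      = ∫ s, g s * ⟪a s, ψ⟫_ℝ ∂μ := by
  have hi := (a.memLp_uncurry_Lp μ m ha).integrable_mul
    (MemLp.mul_prod_of_bound μ m hg hD (Lp.memLp ψ))
  refine (integral_prod _ hi).trans (integral_congr_ae (.of_forall fun s => ?_))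
  simp only [Pi.mul_apply, L2.inner_def, RCLike.inner_apply, conj_trivial]
  rw [← integral_const_mul]
  congr 1 with x
  ring

open scoped InnerProductSpace in
/-- A bounded strongly measurable curve in `L²(m)` is approximated weakly by a bounded sequence in
`L²(μ ⊗ m)`, when tested against products. -/
theorem exists_bounded_seq_tendsto_inner_prod (μ : Measure β) [IsFiniteMeasure μ] (m : Measure α)
    [SigmaFinite m] {u : β → Lp ℝ 2 m} (hu : StronglyMeasurable u) {C : ℝ}
    (hC : 0 ≤ C) (huC : ∀ s, ‖u s‖ ≤ C) :
    ∃ (B : ℝ) (U : ℕ → Lp ℝ 2 (μ.prod m)), (∀ n, ‖U n‖ ≤ B) ∧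
      ∀ (g₁ g₂ : β → ℝ) (ψ₁ ψ₂ : Lp ℝ 2 m) (D : ℝ) (h : Lp ℝ 2 (μ.prod m)),
        AEStronglyMeasurable g₁ μ → AEStronglyMeasurable g₂ μ →
        (∀ᵐ s ∂μ, ‖g₁ s‖ ≤ D) → (∀ᵐ s ∂μ, ‖g₂ s‖ ≤ D) →
        (h : β × α → ℝ) =ᵐ[μ.prod m]
          (fun z => g₁ z.1 * (ψ₁ : α → ℝ) z.2 + g₂ z.1 * (ψ₂ : α → ℝ) z.2) →
        Filter.Tendsto (fun n => ⟪U n, h⟫_ℝ) Filter.atTop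
          (nhds (∫ s, g₁ s * ⟪u s, ψ₁⟫_ℝ + g₂ s * ⟪u s, ψ₂⟫_ℝ ∂μ)) := by
  have ha : ∀ n s, ‖hu.approxBounded C n s‖ ≤ C := fun n s => hu.norm_approxBounded_le hC n s
  have hmem := fun n => (hu.approxBounded C n).memLp_uncurry_Lp μ m (ha n)
  have hfin : (ENNReal.ofReal C ^ (2 : ℝ) * μ univ) ^ (1 / 2 : ℝ) ≠ ⊤ :=
    ENNReal.rpow_ne_top_of_nonneg (by norm_num)
      (ENNReal.mul_ne_top (ENNReal.rpow_ne_top_of_nonneg (by norm_num) ENNReal.ofReal_ne_top)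
        (measure_ne_top _ _))
  refine ⟨((ENNReal.ofReal C ^ (2 : ℝ) * μ univ) ^ (1 / 2 : ℝ)).toReal,
    fun n => (hmem n).toLp _, fun n => ?_, ?_⟩
  · rw [Lp.norm_toLp]
    exact ENNReal.toReal_mono hfin ((hu.approxBounded C n).eLpNorm_uncurry_Lp_le μ m (ha n))
  · intro g₁ g₂ ψ₁ ψ₂ D h hg₁ hg₂ hD₁ hD₂ hh
    have hinner (n : ℕ) (ψ : Lp ℝ 2 m) :
        AEStronglyMeasurable (fun s => ⟪hu.approxBounded C n s, ψ⟫_ℝ) μ :=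
      ((hu.approxBounded C n).stronglyMeasurable.inner stronglyMeasurable_const).aestronglyMeasurable
    have hbound (n : ℕ) (g : β → ℝ) (hD : ∀ᵐ s ∂μ, ‖g s‖ ≤ D) (ψ : Lp ℝ 2 m) :
        ∀ᵐ s ∂μ, ‖g s * ⟪hu.approxBounded C n s, ψ⟫_ℝ‖ ≤ D * (C * ‖ψ‖) := by
      filter_upwards [hD] with s hs
      rw [norm_mul]
      exact mul_le_mul hs ((norm_inner_le_norm _ _).trans (by gcongr; exact ha n s))
        (norm_nonneg _) ((norm_nonneg _).trans hs)
    have hint (n : ℕ) (g : β → ℝ) (hg : AEStronglyMeasurable g μ) (hD : ∀ᵐ s ∂μ, ‖g s‖ ≤ D)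
        (ψ : Lp ℝ 2 m) : Integrable (fun s => g s * ⟪hu.approxBounded C n s, ψ⟫_ℝ) μ :=
      Integrable.of_bound (hg.mul (hinner n ψ)) _ (hbound n g hD ψ)
    have heq (n : ℕ) : ⟪(hmem n).toLp _, h⟫_ℝ
        = ∫ s, g₁ s * ⟪hu.approxBounded C n s, ψ₁⟫_ℝ
            + g₂ s * ⟪hu.approxBounded C n s, ψ₂⟫_ℝ ∂μ := by
      rw [integral_add (hint n g₁ hg₁ hD₁ ψ₁) (hint n g₂ hg₂ hD₂ ψ₂),
        ← (hu.approxBounded C n).integral_uncurry_Lp_mul μ m (ha n) hg₁ hD₁,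
        ← (hu.approxBounded C n).integral_uncurry_Lp_mul μ m (ha n) hg₂ hD₂,
        ← integral_add (f := fun z => _ * (g₁ z.1 * _)) (g := fun z => _ * (g₂ z.1 * _))
          ((hmem n).integrable_mul (MemLp.mul_prod_of_bound μ m hg₁ hD₁ (Lp.memLp ψ₁)))
          ((hmem n).integrable_mul (MemLp.mul_prod_of_bound μ m hg₂ hD₂ (Lp.memLp ψ₂))),
        L2.inner_def]
      refine integral_congr_ae ?_
      filter_upwards [(hmem n).coeFn_toLp, hh] with z h1 h2
      rw [h1, h2]
      simp only [RCLike.inner_apply, conj_trivial]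
      ring
    simp only [heq]
    refine tendsto_integral_of_dominated_convergence
      (fun _ => D * (C * ‖ψ₁‖) + D * (C * ‖ψ₂‖))
      (fun n => (hg₁.mul (hinner n ψ₁)).add (hg₂.mul (hinner n ψ₂)))
      (integrable_const _) (fun n => ?_) (.of_forall fun s => ?_)
    · filter_upwards [hbound n g₁ hD₁ ψ₁, hbound n g₂ hD₂ ψ₂] with s h1 h2
      exact (norm_add_le _ _).trans (add_le_add h1 h2)
    · have h0 := hu.tendsto_approxBounded_of_norm_le (huC s)
      exact ((h0.inner tendsto_const_nhds).const_mul _).add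
        ((h0.inner tendsto_const_nhds).const_mul _)

end MeasureTheory

open scoped InnerProductSpace in
/-- Under the parabolic density hypothesis, the only continuous weak solution of `u' = L₀* u` with
`u 0 = 0` is zero. -/
theorem eq_zero_of_parabolic_density {α : Type*} [MeasurableSpace α] (m : Measure α)
    [SigmaFinite m] (D₀ : Submodule ℝ (Lp ℝ 2 m)) (L₀ : D₀ →ₗ[ℝ] Lp ℝ 2 m) {t : ℝ} (ht : 0 < t)
    (hparab : Dense ((Submodule.span ℝ
        {h : Lp ℝ 2 ((volume.restrict (Set.Icc (0 : ℝ) t)).prod m) |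
          ∃ φ : D₀, ∃ f : ℝ → ℝ, ContDiff ℝ 1 f ∧ f t = 0 ∧
            (h : ℝ × α → ℝ) =ᵐ[(volume.restrict (Set.Icc (0 : ℝ) t)).prod m]
              fun z : ℝ × α =>
                deriv f z.1 * ((φ : Lp ℝ 2 m) : α → ℝ) z.2
                  + f z.1 * (L₀ φ : α → ℝ) z.2} :
        Submodule ℝ (Lp ℝ 2 ((volume.restrict (Set.Icc (0 : ℝ) t)).prod m))) :
        Set (Lp ℝ 2 ((volume.restrict (Set.Icc (0 : ℝ) t)).prod m))))
    {u : ℝ → Lp ℝ 2 m} (hu : Continuous u) {C : ℝ} (huC : ∀ s, ‖u s‖ ≤ C)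
    (hweak : ∀ φ : D₀, ∀ s ∈ Icc 0 t,
      ⟪u s, (φ : Lp ℝ 2 m)⟫_ℝ = ∫ r in (0 : ℝ)..s, ⟪u r, L₀ φ⟫_ℝ) :
    u t = 0 := by
  set μ := volume.restrict (Set.Icc (0 : ℝ) t) with hμ
  have hbdd (g : ℝ → ℝ) (hg : Continuous g) : ∃ D, ∀ᵐ s ∂μ, ‖g s‖ ≤ D := by
    obtain ⟨D, hD⟩ := isCompact_Icc.exists_bound_of_continuousOn (hg.continuousOn (s := Icc 0 t))
    exact ⟨D, (ae_restrict_mem measurableSet_Icc).mono hD⟩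
  obtain ⟨B, U, hUB, hU⟩ := exists_bounded_seq_tendsto_inner_prod μ m hu.stronglyMeasurable
    ((norm_nonneg _).trans (huC 0)) huC
  have hweakU := tendsto_inner_zero_of_dense hUB hparab (fun k hk => by
    induction hk using Submodule.span_induction with
    | zero => simp
    | add x y _ _ hx hy => simpa [inner_add_right] using hx.add hy
    | smul a x _ hx => simpa [inner_smul_right] using hx.const_mul a
    | mem h hh =>
      obtain ⟨φ, f, hf, hft, hh⟩ := hh
      have hf' : Continuous (deriv f) := hf.continuous_deriv le_rfl
      obtain ⟨D₁, hD₁⟩ := hbdd _ hf'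
      obtain ⟨D₂, hD₂⟩ := hbdd _ hf.continuous
      have key := hU (deriv f) f φ (L₀ φ) (max D₁ D₂) h hf'.aestronglyMeasurable
        hf.continuous.aestronglyMeasurable (hD₁.mono fun s hs => hs.trans (le_max_left _ _))
        (hD₂.mono fun s hs => hs.trans (le_max_right _ _)) hh
      convert key using 2
      have hc : Continuous fun r => ⟪u r, L₀ φ⟫_ℝ := hu.inner continuous_const
      have hparts := intervalIntegral.integral_deriv_mul_eq_sub (a := 0) (b := t)
        (u := f) (u' := deriv f) (v := fun s => ∫ r in (0 : ℝ)..s, ⟪u r, L₀ φ⟫_ℝ)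
        (v' := fun r => ⟪u r, L₀ φ⟫_ℝ)
        (fun x _ => (hf.differentiable one_ne_zero x).hasDerivAt)
        (fun x _ => (hc.integral_hasStrictDerivAt 0 x).hasDerivAt)
        (hf'.intervalIntegrable _ _) (hc.intervalIntegrable _ _)
      rw [hft, intervalIntegral.integral_same, zero_mul, mul_zero, sub_zero,
        intervalIntegral.integral_of_le ht.le, ← integral_Icc_eq_integral_Ioc] at hparts
      rw [← hparts]
      refine setIntegral_congr_fun measurableSet_Icc fun s hs => ?_
      simp only [hweak φ s hs])
  have hg : Continuous fun s => ⟪u s, u t⟫_ℝ := hu.inner continuous_const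
  obtain ⟨D, hD⟩ := hbdd _ hg
  have hK := MemLp.mul_prod_of_bound μ m hg.aestronglyMeasurable hD (Lp.memLp (u t))
  have hlim := hU (fun s => ⟪u s, u t⟫_ℝ) 0 (u t) 0 (max D 0) (hK.toLp _) hg.aestronglyMeasurable
    aestronglyMeasurable_zero (hD.mono fun s hs => hs.trans (le_max_left _ _))
    (.of_forall fun s => by simp) (by
      filter_upwards [hK.coeFn_toLp] with z hz
      simp [hz])
  have hzero := tendsto_nhds_unique hlim (hweakU _)
  simp only [Pi.zero_apply, zero_mul, add_zero] at hzero
  rw [hμ, integral_Icc_eq_integral_Ioc, ← intervalIntegral.integral_of_le ht.le] at hzero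
  by_contra hne
  have hpos := intervalIntegral.integral_pos ht (hg.mul hg).continuousOn
    (fun x _ => mul_self_nonneg _)
    ⟨t, right_mem_Icc.2 ht.le, mul_self_pos.2 (inner_self_ne_zero.2 hne)⟩
  exact hpos.ne' hzero

open scoped InnerProductSpace in
theorem IsSelfAdjointOp.inner_left {α : Type*} [MeasurableSpace α] {m : Measure α}
    {S : Lp ℝ 2 m →L[ℝ] Lp ℝ 2 m} (hS : IsSelfAdjointOp m S) (v w : Lp ℝ 2 m) :
    ⟪S v, w⟫_ℝ = ⟪v, S w⟫_ℝ := by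
  simpa [L2.inner_def, mul_comm] using hS v w

open scoped InnerProductSpace in
/-- Orbits of a self-adjoint semigroup whose generator extends `L₀` are weak solutions. -/
theorem IsStrongSemigroup.inner_eq_add_integral {α : Type*} [MeasurableSpace α] {m : Measure α}
    {T : ℝ → Lp ℝ 2 m →L[ℝ] Lp ℝ 2 m} (hT : IsStrongSemigroup T)
    (hsa : ∀ t : ℝ, 0 ≤ t → IsSelfAdjointOp m (T t)) {φ ψ : Lp ℝ 2 m}
    (hgen : ∀ t : ℝ, 0 ≤ t → T t φ = φ + ∫ s in (0 : ℝ)..t, T s ψ)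
    (v : Lp ℝ 2 m) {s : ℝ} (hs : 0 ≤ s) :
    ⟪T s v, φ⟫_ℝ = ⟪v, φ⟫_ℝ + ∫ r in (0 : ℝ)..s, ⟪T r v, ψ⟫_ℝ := by
  have hint : IntervalIntegrable (fun r => T r ψ) volume 0 s :=
    ((hT.2.2 ψ).mono (by rw [uIcc_of_le hs]; exact Icc_subset_Ici_self)).intervalIntegrable
  rw [(hsa s hs).inner_left, hgen s hs, inner_add_right, ← innerSL_apply_apply ℝ v (∫ _ in _.._, _),
    ← ContinuousLinearMap.intervalIntegral_comp_comm _ hint]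
  congr 1
  refine intervalIntegral.integral_congr fun r hr => ?_
  rw [uIcc_of_le hs] at hr
  simp only [innerSL_apply_apply, (hsa r hr.1).inner_left]

/-- Let `(E, 𝓑, m)` be σ-finite, `D₀` a dense subspace of `L²(m)` and
`L₀ : D₀ → L²(m)` a symmetric linear operator. If for every `T ∈ (0, ∞)` the span of the
functions `(s,x) ↦ f'(s)φ(x) + f(s)(L₀φ)(x)` (with `φ ∈ D₀`, `f` of class `C¹`, `f(T) = 0`)
is dense in `L²([0,T] × E, dt ⊗ m)`, then any two strongly continuous semigroups of
self-adjoint operators on `L²(m)` whose generators extend `(L₀, D₀)` coincide. -/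
theorem symmetric_semigroup_uniqueness_of_parabolic_density
    {α : Type*} [MeasurableSpace α] (m : Measure α) [SigmaFinite m]
    (D₀ : Submodule ℝ (Lp ℝ 2 m)) (hdense : Dense (D₀ : Set (Lp ℝ 2 m)))
    (L₀ : D₀ →ₗ[ℝ] Lp ℝ 2 m)
    (hsymm : ∀ φ ψ : D₀,
      ∫ x, (L₀ φ : α → ℝ) x * ((ψ : Lp ℝ 2 m) : α → ℝ) x ∂m
        = ∫ x, ((φ : Lp ℝ 2 m) : α → ℝ) x * (L₀ ψ : α → ℝ) x ∂m)
    (hparab : ∀ T : ℝ, 0 < T →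
      Dense ((Submodule.span ℝ
        {h : Lp ℝ 2 ((volume.restrict (Set.Icc (0 : ℝ) T)).prod m) |
          ∃ φ : D₀, ∃ f : ℝ → ℝ, ContDiff ℝ 1 f ∧ f T = 0 ∧
            (h : ℝ × α → ℝ) =ᵐ[(volume.restrict (Set.Icc (0 : ℝ) T)).prod m]
              fun z : ℝ × α =>
                deriv f z.1 * ((φ : Lp ℝ 2 m) : α → ℝ) z.2
                  + f z.1 * (L₀ φ : α → ℝ) z.2} :
        Submodule ℝ (Lp ℝ 2 ((volume.restrict (Set.Icc (0 : ℝ) T)).prod m))) :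
        Set (Lp ℝ 2 ((volume.restrict (Set.Icc (0 : ℝ) T)).prod m))))
    (T T' : ℝ → Lp ℝ 2 m →L[ℝ] Lp ℝ 2 m)
    (hT : IsStrongSemigroup T) (hT' : IsStrongSemigroup T')
    (hTsa : ∀ t : ℝ, 0 ≤ t → IsSelfAdjointOp m (T t))
    (hT'sa : ∀ t : ℝ, 0 ≤ t → IsSelfAdjointOp m (T' t))
    (hTgen : ∀ φ : D₀, ∀ t : ℝ, 0 ≤ t →
      T t (φ : Lp ℝ 2 m) = (φ : Lp ℝ 2 m) + ∫ s in (0 : ℝ)..t, T s (L₀ φ))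
    (hT'gen : ∀ φ : D₀, ∀ t : ℝ, 0 ≤ t →
      T' t (φ : Lp ℝ 2 m) = (φ : Lp ℝ 2 m) + ∫ s in (0 : ℝ)..t, T' s (L₀ φ)) :
    ∀ t : ℝ, 0 ≤ t → T t = T' t := by
  intro t ht
  rcases ht.eq_or_lt with rfl | htpos
  · rw [hT.1, hT'.1]
  ext1 v
  have hd : ContinuousOn (fun s => T s v - T' s v) (Icc 0 t) :=
    ((hT.2.2 v).sub (hT'.2.2 v)).mono Icc_subset_Ici_self
  obtain ⟨C, hC⟩ := isCompact_Icc.exists_bound_of_continuousOn hd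
  set u : ℝ → Lp ℝ 2 m := IccExtend ht ((Icc 0 t).domRestrict fun s => T s v - T' s v) with hu_def
  have hu : Continuous u := (continuousOn_iff_continuous_domRestrict.1 hd).Icc_extend'
  have huC : ∀ s, ‖u s‖ ≤ C := fun s => hC _ (projIcc 0 t ht s).2
  have hu_eq : ∀ s ∈ Icc 0 t, u s = T s v - T' s v := fun s hs => by
    rw [hu_def, IccExtend_of_mem _ _ hs]
    rfl
  have hzero := eq_zero_of_parabolic_density m D₀ L₀ htpos (hparab t htpos) hu huC
    (fun φ s hs => by
      have hint {R : ℝ → Lp ℝ 2 m →L[ℝ] Lp ℝ 2 m} (hR : IsStrongSemigroup R) :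
          IntervalIntegrable (fun r => inner ℝ (R r v) (L₀ φ)) volume 0 s := by
        refine ContinuousOn.intervalIntegrable (((hR.2.2 v).mono ?_).inner continuousOn_const)
        rw [uIcc_of_le hs.1]
        exact Icc_subset_Ici_self
      rw [hu_eq s hs, inner_sub_left, hT.inner_eq_add_integral hTsa (hTgen φ) v hs.1,
        hT'.inner_eq_add_integral hT'sa (hT'gen φ) v hs.1, add_sub_add_left_eq_sub,
        ← intervalIntegral.integral_sub (hint hT) (hint hT')]
      refine intervalIntegral.integral_congr fun r hr => ?_
      rw [uIcc_of_le hs.1] at hr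
      simp only [hu_eq r ⟨hr.1, hr.2.trans hs.2⟩, inner_sub_left])
  rw [hu_eq t (right_mem_Icc.2 ht)] at hzero
  exact sub_eq_zero.1 hzero

end
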